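/- Let u₀, v₀ : ℝ × ℝ → ℝ be C^∞ functions of (t,x) satisfying at every point the unperturbed system u₀_t + (1/2) v₀_{xx} + v₀ (u₀² + v₀²) = 0 and v₀_t − (1/2) u₀_{xx} − u₀ (u₀² + v₀²) = 0. Then the conservation law ∂_t[ (1/2)(u₀_x² + v₀_x²) + 2 x u₀³ u₀_x − (1/2) v₀² (2 u₀² + v₀²) ] + ∂_x[ −(u₀_t u₀_x + v₀_t v₀_x + 2 x u₀³ u₀_t) ] = 0 holds at every point. -/

import Mathlib

noncomputable def pt (f : ℝ × ℝ → ℝ) : ℝ × ℝ → ℝ := fun p => deriv (fun s => f (s, p.2)) p.1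
noncomputable def px (f : ℝ × ℝ → ℝ) : ℝ × ℝ → ℝ := fun p => deriv (fun y => f (p.1, y)) p.2

theorem pt_eq_fderiv {f : ℝ × ℝ → ℝ} (hf : Differentiable ℝ f) :
    pt f = fun p => fderiv ℝ f p (1, 0) := by
  funext p
  have hg : HasDerivAt (fun s : ℝ => (s, p.2)) ((1 : ℝ), (0 : ℝ)) p.1 :=
    (hasDerivAt_id p.1).prodMk (hasDerivAt_const p.1 p.2)
  exact ((hf p).hasFDerivAt.comp_hasDerivAt p.1 hg).deriv

theorem px_eq_fderiv {f : ℝ × ℝ → ℝ} (hf : Differentiable ℝ f) :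
    px f = fun p => fderiv ℝ f p (0, 1) := by
  funext p
  have hg : HasDerivAt (fun y : ℝ => (p.1, y)) ((0 : ℝ), (1 : ℝ)) p.2 :=
    (hasDerivAt_const p.2 p.1).prodMk (hasDerivAt_id p.2)
  exact ((hf p).hasFDerivAt.comp_hasDerivAt p.2 hg).deriv

theorem contDiff_pt {f : ℝ × ℝ → ℝ} (hf : ContDiff ℝ (⊤ : ℕ∞) f) :
    ContDiff ℝ (⊤ : ℕ∞) (pt f) := by
  rw [pt_eq_fderiv (hf.differentiable (by simp))]
  exact (hf.fderiv_right (m := (⊤ : ℕ∞)) (by simp)).clm_apply contDiff_const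

theorem contDiff_px {f : ℝ × ℝ → ℝ} (hf : ContDiff ℝ (⊤ : ℕ∞) f) :
    ContDiff ℝ (⊤ : ℕ∞) (px f) := by
  rw [px_eq_fderiv (hf.differentiable (by simp))]
  exact (hf.fderiv_right (m := (⊤ : ℕ∞)) (by simp)).clm_apply contDiff_const

theorem hasDerivAt_pt {f : ℝ × ℝ → ℝ} (hf : ContDiff ℝ (⊤ : ℕ∞) f) (p : ℝ × ℝ) :
    HasDerivAt (fun s => f (s, p.2)) (pt f p) p.1 := by
  have hd : Differentiable ℝ f := hf.differentiable (by simp)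
  have h : Differentiable ℝ (fun s => f (s, p.2)) := by fun_prop
  exact (h p.1).hasDerivAt

theorem hasDerivAt_px {f : ℝ × ℝ → ℝ} (hf : ContDiff ℝ (⊤ : ℕ∞) f) (p : ℝ × ℝ) :
    HasDerivAt (fun y => f (p.1, y)) (px f p) p.2 := by
  have hd : Differentiable ℝ f := hf.differentiable (by simp)
  have h : Differentiable ℝ (fun y => f (p.1, y)) := by fun_prop
  exact (h p.2).hasDerivAt

theorem pt_px_comm {f : ℝ × ℝ → ℝ} (hf : ContDiff ℝ (⊤ : ℕ∞) f) (p : ℝ × ℝ) :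
    pt (px f) p = px (pt f) p := by
  have hd : Differentiable ℝ f := hf.differentiable (by simp)
  have hd' : Differentiable ℝ (fderiv ℝ f) :=
    (hf.fderiv_right (m := (⊤ : ℕ∞)) (by simp)).differentiable (by simp)
  rw [pt_eq_fderiv ((contDiff_px hf).differentiable (by simp)),
    px_eq_fderiv ((contDiff_pt hf).differentiable (by simp)), pt_eq_fderiv hd, px_eq_fderiv hd]
  have hsymm : IsSymmSndFDerivAt ℝ f p :=
    hf.contDiffAt.isSymmSndFDerivAt (by
      rw [minSmoothness_of_isRCLikeNormedField]
      exact WithTop.coe_le_coe.2 (le_top : (2 : ℕ∞) ≤ ⊤))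
  have key (v w : ℝ × ℝ) :
      fderiv ℝ (fun q => fderiv ℝ f q v) p w = fderiv ℝ (fderiv ℝ f) p w v := by
    rw [fderiv_clm_apply (hd' p) (differentiableAt_const v)]
    simp
  exact (key _ _).trans ((hsymm _ _).trans (key _ _).symm)

theorem stmt15 (u₀ v₀ : ℝ × ℝ → ℝ)
    (hu₀ : ContDiff ℝ (⊤ : ℕ∞) u₀) (hv₀ : ContDiff ℝ (⊤ : ℕ∞) v₀)
    (h1 : ∀ p : ℝ × ℝ, pt u₀ p + (1 / 2) * px (px v₀) p + v₀ p * ((u₀ p) ^ 2 + (v₀ p) ^ 2) = 0)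
    (h2 : ∀ p : ℝ × ℝ, pt v₀ p - (1 / 2) * px (px u₀) p - u₀ p * ((u₀ p) ^ 2 + (v₀ p) ^ 2) = 0) :
    ∀ p : ℝ × ℝ,
      pt (fun q => (1 / 2) * ((px u₀ q) ^ 2 + (px v₀ q) ^ 2) + 2 * q.2 * (u₀ q) ^ 3 * px u₀ q
          - (1 / 2) * (v₀ q) ^ 2 * (2 * (u₀ q) ^ 2 + (v₀ q) ^ 2)) p
      + px (fun q => -(pt u₀ q * px u₀ q + pt v₀ q * px v₀ q
          + 2 * q.2 * (u₀ q) ^ 3 * pt u₀ q)) p = 0 := by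
  intro p
  have ut := hasDerivAt_pt hu₀ p
  have vt := hasDerivAt_pt hv₀ p
  have uxt := hasDerivAt_pt (contDiff_px hu₀) p
  have vxt := hasDerivAt_pt (contDiff_px hv₀) p
  have ux := hasDerivAt_px hu₀ p
  have uxx := hasDerivAt_px (contDiff_px hu₀) p
  have vxx := hasDerivAt_px (contDiff_px hv₀) p
  have utx := hasDerivAt_px (contDiff_pt hu₀) p
  have vtx := hasDerivAt_px (contDiff_pt hv₀) p
  have density := ((((uxt.fun_pow 2).fun_add (vxt.fun_pow 2)).const_mul (1 / 2)).fun_add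
    (((ut.fun_pow 3).const_mul (2 * p.2)).fun_mul uxt)).fun_sub
    (((vt.fun_pow 2).const_mul (1 / 2)).fun_mul
      (((ut.fun_pow 2).const_mul 2).fun_add (vt.fun_pow 2)))
  have flux := (((utx.fun_mul uxx).fun_add (vtx.fun_mul vxx)).fun_add
    ((((hasDerivAt_id' p.2).const_mul 2).fun_mul (ux.fun_pow 3)).fun_mul utx)).fun_neg
  have density_eq := density.deriv
  have flux_eq := flux.deriv
  rw [pt_px_comm hu₀, pt_px_comm hv₀] at density_eq
  rw [pt, px, density_eq, flux_eq]
  push_cast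
  linear_combination (-2 * pt v₀ p) * h1 p + (2 * pt u₀ p) * h2 p
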